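/- Let P ⊆ ℝ^d be a rational d-polytope with denominator p and let u ∈ ℝ^d be a fixed vector. For integers t ≥ 1 let D_{P,u}(t) = #{m ∈ ℤ^d : there is ε₀ > 0 such that m + ε·u ∈ tP for all ε ∈ (0, ε₀]}. Then there exist polynomials q_0, …, q_{p−1} ∈ ℚ[T], the maximum of whose degrees is d, such that D_{P,u}(t) = q_{t mod p}(t) for every integer t ≥ 1; in particular, if all vertices of P lie in ℤ^d then D_{P,u} agrees with a single polynomial of degree d on positive integers. -/

import Mathlib

open Set Polynomial Pointwise

noncomputable section

/-- The residue of an integer `t` modulo a positive integer `p`, as an element of `Fin p`. -/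
def resMod (p : ℕ) (hp : 0 < p) (t : ℤ) : Fin p :=
  ⟨(t % (p : ℤ)).toNat, by
    have h1 : 0 ≤ t % (p : ℤ) := Int.emod_nonneg t (by exact_mod_cast hp.ne')
    have h2 : t % (p : ℤ) < (p : ℤ) := Int.emod_lt_of_pos t (by exact_mod_cast hp)
    omega⟩

/-- The set of lattice points `m ∈ ℤ^d` such that `m + ε•u ∈ A` for all sufficiently
small `ε > 0`. -/
def DSet (d : ℕ) (u : Fin d → ℝ) (A : Set (Fin d → ℝ)) : Set (Fin d → ℤ) :=
  {m | ∃ ε₀ > (0 : ℝ), ∀ ε : ℝ, 0 < ε → ε ≤ ε₀ → (fun i => (m i : ℝ)) + ε • u ∈ A}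

open Filter Topology

/-- The cone spanned by the vectors `w i`, `i ∈ I`. -/
def coneOn {ι E : Type*} [AddCommGroup E] [Module ℝ E] (w : ι → E) (I : Finset ι) : Set E :=
  {x | ∃ μ : ι → ℝ, (∀ i ∈ I, 0 ≤ μ i) ∧ ∑ i ∈ I, μ i • w i = x}

open Classical in
/-- The rational-valued indicator function of `coneOn w I`. -/
def coneInd {ι E : Type*} [AddCommGroup E] [Module ℝ E] (w : ι → E) (I : Finset ι) (x : E) : ℚ :=
  if x ∈ coneOn w I then 1 else 0

open Classical in
lemma eventually_indicator_sub_eq_isGreatest {J : Set ℝ} (hc : IsCompact J) (ho : J.OrdConnected)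
    (r : ℝ) : ∀ᶠ δ in 𝓝[>] (0 : ℝ),
      ((if r ∈ J then 1 else 0) - (if r + δ ∈ J then 1 else 0) : ℚ) =
        if IsGreatest J r then 1 else 0 := by
  by_cases hr : r ∈ J
  · by_cases hg : IsGreatest J r
    · filter_upwards [self_mem_nhdsWithin] with δ hδ
      have : r + δ ∉ J := fun h => by
        have := hg.2 h
        have : 0 < δ := hδ
        linarith
      simp [hr, hg, this]
    · have : ∃ b ∈ J, r < b := by
        by_contra! h
        exact hg ⟨hr, h⟩
      obtain ⟨b, hb, hrb⟩ := this
      filter_upwards [Ioo_mem_nhdsGT (sub_pos.2 hrb)] with δ hδ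
      have : r + δ ∈ J := ho.out hr hb ⟨by linarith [hδ.1], by linarith [hδ.2]⟩
      simp [hr, hg, this]
  · have hg : ¬ IsGreatest J r := fun h => hr h.1
    have h1 : ∀ᶠ y in 𝓝 r, y ∉ J := hc.isClosed.isOpen_compl.mem_nhds hr
    have h2 : Tendsto (fun δ : ℝ => r + δ) (𝓝[>] 0) (𝓝 r) := by
      have : Tendsto (fun δ : ℝ => r + δ) (𝓝 0) (𝓝 (r + 0)) :=
        (continuous_const.add continuous_id).tendsto 0
      rw [add_zero] at this
      exact this.mono_left nhdsWithin_le_nhds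
    filter_upwards [h2.eventually h1] with δ hδ
    simp [hr, hg, hδ]

open Classical in
/-- A linear relation between indicator functions of compact intervals implies the same relation
between their Euler characteristics. -/
lemma nonempty_eq_sum_of_indicator_eq_sum {α : Type*} (T : Finset α) (c : α → ℚ) (J : α → Set ℝ)
    (J₀ : Set ℝ) (hJ₀ : IsCompact J₀ ∧ J₀.OrdConnected)
    (hJ : ∀ a ∈ T, IsCompact (J a) ∧ (J a).OrdConnected)
    (h : ∀ r, (if r ∈ J₀ then 1 else 0 : ℚ) = ∑ a ∈ T, c a * if r ∈ J a then 1 else 0) :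
    (if J₀.Nonempty then 1 else 0 : ℚ) = ∑ a ∈ T, c a * if (J a).Nonempty then 1 else 0 := by
  have key : ∀ r, (if IsGreatest J₀ r then 1 else 0 : ℚ) =
      ∑ a ∈ T, c a * if IsGreatest (J a) r then 1 else 0 := by
    intro r
    have h1 := eventually_indicator_sub_eq_isGreatest hJ₀.1 hJ₀.2 r
    have h2 : ∀ᶠ δ in 𝓝[>] (0 : ℝ), ∀ a ∈ T,
      ((if r ∈ J a then 1 else 0) - (if r + δ ∈ J a then 1 else 0) : ℚ) =
        if IsGreatest (J a) r then 1 else 0 :=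
      (Filter.eventually_all_finset T).2 fun a ha =>
        eventually_indicator_sub_eq_isGreatest (hJ a ha).1 (hJ a ha).2 r
    obtain ⟨δ, hδ1, hδ2⟩ := (h1.and h2).exists
    rw [← hδ1, h, h, ← Finset.sum_sub_distrib]
    refine Finset.sum_congr rfl fun a ha => ?_
    rw [← hδ2 a ha]
    ring
  let R : Finset ℝ := insert (sSup J₀) (T.image fun a => sSup (J a))
  have count : ∀ K : Set ℝ, IsCompact K → sSup K ∈ R →
      ∑ r ∈ R, (if IsGreatest K r then 1 else 0 : ℚ) = if K.Nonempty then 1 else 0 := by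
    intro K hK hR
    by_cases hne : K.Nonempty
    · have hg := hK.isGreatest_sSup hne
      rw [Finset.sum_eq_single (sSup K)]
      · simp [hg, hne]
      · intro b _ hb
        rw [if_neg]
        exact fun h' => hb (h'.unique hg)
      · exact fun h' => absurd hR h'
    · rw [if_neg hne]
      exact Finset.sum_eq_zero fun r _ => if_neg fun h' => hne ⟨r, h'.1⟩
  rw [← count J₀ hJ₀.1 (Finset.mem_insert_self _ _), Finset.sum_congr rfl fun r _ => key r,
    Finset.sum_comm]
  refine Finset.sum_congr rfl fun a ha => ?_
  rw [← Finset.mul_sum, count (J a) (hJ a ha).1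
    (Finset.mem_insert_of_mem (Finset.mem_image_of_mem _ ha))]

lemma convex_coneOn {ι E : Type*} [AddCommGroup E] [Module ℝ E] (w : ι → E) (I : Finset ι) :
    Convex ℝ (coneOn w I) := by
  rintro x ⟨μ, hμ, rfl⟩ y ⟨ν, hν, rfl⟩ a b ha hb _
  refine ⟨fun i => a * μ i + b * ν i, fun i hi => ?_, ?_⟩
  · have := hμ i hi
    have := hν i hi
    positivity
  · simp [add_smul, mul_smul, Finset.sum_add_distrib, Finset.smul_sum]

section Sweep

variable {ι E : Type*} [NormedAddCommGroup E] [NormedSpace ℝ E]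

lemma mem_coneOn_insert_iff [DecidableEq ι] (w : ι → E) {I : Finset ι} {v : ι} (hv : v ∉ I)
    (x : E) :
    x ∈ coneOn w (insert v I) ↔ {s : ℝ | 0 ≤ s ∧ x - s • w v ∈ coneOn w I}.Nonempty := by
  constructor
  · rintro ⟨μ, hμ, rfl⟩
    refine ⟨μ v, hμ v (Finset.mem_insert_self _ _), μ,
      fun i hi => hμ i (Finset.mem_insert_of_mem hi), ?_⟩
    rw [Finset.sum_insert hv, add_sub_cancel_left]
  · rintro ⟨s, hs, μ, hμ, hx⟩
    refine ⟨Function.update μ v s, fun i hi => ?_, ?_⟩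
    · rcases eq_or_ne i v with rfl | hne
      · simpa using hs
      · simpa [hne] using hμ i ((Finset.mem_insert.1 hi).resolve_left hne)
    · rw [Finset.sum_insert hv, Function.update_self]
      have : ∑ i ∈ I, Function.update μ v s i • w i = ∑ i ∈ I, μ i • w i :=
        Finset.sum_congr rfl fun i hi => by
          rw [Function.update_of_ne (ne_of_mem_of_not_mem hi hv)]
      rw [this, hx, add_sub_cancel]

lemma mem_coneOn_insert_iff_nonempty [DecidableEq ι] (w : ι → E) (I : Finset ι) (v : ι) (x : E) :
    x ∈ coneOn w (insert v I) ↔ {s : ℝ | 0 ≤ s ∧ x - s • w v ∈ coneOn w I}.Nonempty := by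
  by_cases hv : v ∈ I
  swap
  · exact mem_coneOn_insert_iff w hv x
  rw [Finset.insert_eq_of_mem hv]
  constructor
  · exact fun hx => ⟨0, le_rfl, by simpa using hx⟩
  · rintro ⟨s, hs, μ, hμ, hx⟩
    refine ⟨fun i => μ i + if i = v then s else 0, fun i hi => ?_, ?_⟩
    · have := hμ i hi
      positivity
    · simp [add_smul, Finset.sum_add_distrib, ite_smul, hv, hx]

lemma ordConnected_sweep (w : ι → E) (I : Finset ι) (v x : E) :
    {s : ℝ | 0 ≤ s ∧ x - s • v ∈ coneOn w I}.OrdConnected := by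
  apply Convex.ordConnected
  rintro a ⟨ha, ha'⟩ b ⟨hb, hb'⟩ α β hα hβ hαβ
  refine ⟨by simp only [smul_eq_mul]; positivity, ?_⟩
  convert convex_coneOn w I ha' hb' hα hβ hαβ using 1
  have : x = (α + β) • x := by rw [hαβ, one_smul]
  nth_rewrite 1 [this]
  simp only [smul_eq_mul]
  module

lemma isCompact_sweep (w : ι → E) (h : E →ₗ[ℝ] ℝ) (hw : ∀ i, h (w i) = 1) (I : Finset ι)
    (v : ι) (x : E) : IsCompact {s : ℝ | 0 ≤ s ∧ x - s • w v ∈ coneOn w I} := by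
  classical
  have hK : IsCompact ((Icc (0 : ℝ) (h x) ×ˢ Set.pi univ fun _ : ι => Icc (0 : ℝ) (h x)) ∩
      {z : ℝ × (ι → ℝ) | ∑ i ∈ I, z.2 i • w i = x - z.1 • w v}) := by
    apply (isCompact_Icc.prod (isCompact_univ_pi fun _ => isCompact_Icc)).inter_right
    apply isClosed_eq <;> fun_prop
  convert hK.image continuous_fst using 1
  ext s
  simp only [mem_ofPred_eq, mem_image, mem_inter_iff, mem_prod, Prod.exists, exists_and_right,
    exists_eq_right]
  constructor
  · rintro ⟨hs, μ, hμ, hx⟩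
    have hh := congrArg h hx
    simp only [map_sum, map_smul, hw, smul_eq_mul, mul_one, map_sub] at hh
    have hsum : 0 ≤ ∑ i ∈ I, μ i := Finset.sum_nonneg hμ
    have hx0 : s ≤ h x := by linarith
    refine ⟨fun i => if i ∈ I then μ i else 0, ⟨⟨hs, hx0⟩, fun i _ => ?_⟩, ?_⟩
    · by_cases hi : i ∈ I
      · simp only [hi, if_true]
        exact ⟨hμ i hi, (Finset.single_le_sum hμ hi).trans (by linarith)⟩
      · simp only [hi, if_false]
        exact ⟨le_rfl, hs.trans hx0⟩
    · rw [← hx]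
      exact Finset.sum_congr rfl fun i hi => by simp [hi]
  · rintro ⟨μ, ⟨hs, hμ⟩, hx⟩
    exact ⟨hs.1, μ, fun i _ => (hμ i trivial).1, hx⟩

lemma sum_eq_of_linearIndepOn {w : ι → E} {I : Finset ι} (hI : LinearIndepOn ℝ w (I : Set ι))
    {μ ν : ι → ℝ} (h : ∑ i ∈ I, μ i • w i = ∑ i ∈ I, ν i • w i) : ∀ i ∈ I, μ i = ν i := by
  intro i hi
  have := linearIndepOn_finset_iff.1 hI (fun i => μ i - ν i)
    (by simp [sub_smul, Finset.sum_sub_distrib, h]) i hi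
  linarith

/-- The inclusion-exclusion relation attached to a circuit. -/
lemma coneInd_insert_mem_span [DecidableEq ι] (w : ι → E) (h : E →ₗ[ℝ] ℝ) (hw : ∀ i, h (w i) = 1)
    {I : Finset ι} (hI : LinearIndepOn ℝ w (I : Set ι)) {v : ι} (hv : v ∉ I) :
    coneInd w (insert v I) ∈ Submodule.span ℚ
      (coneInd w '' {L : Finset ι | LinearIndepOn ℝ w (L : Set ι)}) := by
  classical
  by_cases hvs : w v ∈ Submodule.span ℝ (w '' (I : Set ι))
  swap
  · refine Submodule.subset_span ⟨_, ?_, rfl⟩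
    rw [mem_ofPred_eq, Finset.coe_insert, linearIndepOn_insert (by simpa using hv)]
    exact ⟨hI, hvs⟩
  obtain ⟨a, ha⟩ : ∃ a : ι → ℝ, ∑ i ∈ I, a i • w i = w v := by
    obtain ⟨c, hc⟩ := (Submodule.mem_span_image_finset_iff_exists_fun ℝ).1 hvs
    refine ⟨fun i => if hi : i ∈ I then c ⟨i, hi⟩ else 0, ?_⟩
    rw [← hc, ← Finset.sum_coe_sort]
    simp
  let Q := I.filter fun i => 0 < a i
  have hQ : Q.Nonempty := by
    have hh := congrArg h ha
    simp only [map_sum, map_smul, hw, smul_eq_mul, mul_one] at hh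
    obtain ⟨i, hi, hi'⟩ := Finset.exists_lt_of_sum_lt (s := I) (f := fun _ => (0 : ℝ)) (g := a)
      (by simp [hh])
    exact ⟨i, Finset.mem_filter.2 ⟨hi, hi'⟩⟩
  have hQI : Q ⊆ I := Finset.filter_subset _ _
  have ins : ∀ S ⊆ Q, insert v I \ S = insert v (I \ S) := fun S hS =>
    Finset.insert_sdiff_of_notMem _ fun hvS => hv (hQI (hS hvS))
  have indep : ∀ S ⊆ Q, S.Nonempty → LinearIndepOn ℝ w ((insert v I \ S : Finset ι) : Set ι) := by
    rintro S hS ⟨j, hj⟩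
    rw [ins S hS, Finset.coe_insert, linearIndepOn_insert (by simp [hv])]
    refine ⟨hI.mono (by simp), fun hsp => ?_⟩
    obtain ⟨c, hc⟩ := (Submodule.mem_span_image_finset_iff_exists_fun ℝ).1 hsp
    have hc' : ∑ i ∈ I, (if hi : i ∈ I \ S then c ⟨i, hi⟩ else 0) • w i = w v := by
      rw [← hc, ← Finset.sum_subset (Finset.sdiff_subset (s := I) (t := S)),
        ← Finset.sum_coe_sort]
      · simp
      · intro i _ hi
        simp only [hi, dite_false, zero_smul]
    have := sum_eq_of_linearIndepOn hI (ha.trans hc'.symm) j (hQI (hS hj))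
    have hpos := (Finset.mem_filter.1 (hS hj)).2
    simp [hj] at this
    linarith
  have rel : ∑ S ∈ Q.powerset, ((-1 : ℚ) ^ S.card) • coneInd w (insert v I \ S) = 0 := by
    ext x
    simp only [Finset.sum_apply, Pi.smul_apply, smul_eq_mul, Pi.zero_apply]
    by_cases hx : x ∈ coneOn w (insert v I)
    swap
    · refine Finset.sum_eq_zero fun S _ => ?_
      have : x ∉ coneOn w (insert v I \ S) := by
        rintro ⟨μ, hμ, rfl⟩
        refine hx ⟨fun i => if i ∈ S then 0 else μ i, fun i hi => ?_, ?_⟩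
        · by_cases hiS : i ∈ S
          · simp [hiS]
          · simpa [hiS] using hμ i (Finset.mem_sdiff.2 ⟨hi, hiS⟩)
        · rw [← Finset.sum_subset (Finset.sdiff_subset (s := insert v I) (t := S))]
          · refine Finset.sum_congr rfl fun i hi => ?_
            simp [(Finset.mem_sdiff.1 hi).2]
          · intro i hi hi'
            have : i ∈ S := by
              by_contra hc
              exact hi' (Finset.mem_sdiff.2 ⟨hi, hc⟩)
            simp [this]
      simp [coneInd, this]
    obtain ⟨s, hs, b, hb, hxb⟩ := (mem_coneOn_insert_iff w hv x).1 hx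
    obtain ⟨j, hjQ, hj⟩ := Q.exists_min_image (fun i => b i / a i) hQ
    set c := b j / a j
    have haj : 0 < a j := (Finset.mem_filter.1 hjQ).2
    have hc0 : 0 ≤ c := div_nonneg (hb j (hQI hjQ)) haj.le
    set b' : ι → ℝ := fun i => b i - c * a i with hb'
    have hb'0 : ∀ i ∈ I, 0 ≤ b' i := by
      intro i hi
      by_cases hai : 0 < a i
      · have := hj i (Finset.mem_filter.2 ⟨hi, hai⟩)
        rw [le_div_iff₀ hai] at this
        simp only [hb']
        linarith
      · have := hb i hi
        have : c * a i ≤ 0 := mul_nonpos_of_nonneg_of_nonpos hc0 (not_lt.1 hai)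
        simp only [hb']
        linarith
    have hb'j : b' j = 0 := by
      simp only [hb', c]
      field_simp
      ring
    have hxb' : ∑ i ∈ I, b' i • w i = x - (s + c) • w v := by
      simp only [hb', sub_smul, Finset.sum_sub_distrib, mul_smul, ← Finset.smul_sum, ha, hxb]
      module
    let Z := Q.filter fun i => b' i = 0
    have hZ : Z.Nonempty := ⟨j, Finset.mem_filter.2 ⟨hjQ, hb'j⟩⟩
    have mem_iff : ∀ S ⊆ Q, (x ∈ coneOn w (insert v I \ S) ↔ S ⊆ Z) := by
      intro S hS
      have hv' : v ∉ I \ S := by simp [hv]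
      rw [ins S hS, mem_coneOn_insert_iff w hv']
      constructor
      · rintro ⟨r, hr, ν, hν, hxν⟩ i hi
        have hsum : ∑ i ∈ I, (if i ∈ S then 0 else ν i) • w i = x - r • w v := by
          rw [← hxν, ← Finset.sum_subset (Finset.sdiff_subset (s := I) (t := S))]
          · refine Finset.sum_congr rfl fun i hi => ?_
            simp [(Finset.mem_sdiff.1 hi).2]
          · intro i hi hi'
            have : i ∈ S := by
              by_contra hc
              exact hi' (Finset.mem_sdiff.2 ⟨hi, hc⟩)
            simp [this]
        have hco : ∀ i ∈ I, (if i ∈ S then 0 else ν i) = b' i + (s + c - r) * a i := by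
          apply sum_eq_of_linearIndepOn hI
          simp only [add_smul, Finset.sum_add_distrib, mul_smul, ← Finset.smul_sum, ha, hxb', hsum]
          module
        have h1 : 0 ≤ s + c - r := by
          have h2 := hco j (hQI hjQ)
          have h3 : 0 ≤ if j ∈ S then 0 else ν j := by
            split_ifs with hjS
            · exact le_rfl
            · exact hν j (Finset.mem_sdiff.2 ⟨hQI hjQ, hjS⟩)
          rw [h2, hb'j, zero_add] at h3
          exact nonneg_of_mul_nonneg_left h3 haj
        have h4 := hco i (hQI (hS hi))
        rw [if_pos hi] at h4
        have h5 := hb'0 i (hQI (hS hi))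
        have h6 := mul_nonneg h1 (Finset.mem_filter.1 (hS hi)).2.le
        exact Finset.mem_filter.2 ⟨hS hi, by linarith⟩
      · intro hSZ
        refine ⟨s + c, add_nonneg hs hc0, b', fun i hi => hb'0 i (Finset.mem_sdiff.1 hi).1, ?_⟩
        rw [← hxb']
        apply Finset.sum_subset Finset.sdiff_subset
        intro i hi hi'
        have : i ∈ S := by
          by_contra hc
          exact hi' (Finset.mem_sdiff.2 ⟨hi, hc⟩)
        rw [(Finset.mem_filter.1 (hSZ this)).2, zero_smul]
    have hZQ : Z.powerset ⊆ Q.powerset := Finset.powerset_mono.2 (Finset.filter_subset _ _)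
    rw [← Finset.sum_subset hZQ]
    · have := Finset.sum_powerset_neg_one_pow_card_of_nonempty hZ
      have h2 : ∑ S ∈ Z.powerset, (-1 : ℚ) ^ S.card = 0 := by exact_mod_cast this
      rw [← h2]
      refine Finset.sum_congr rfl fun S hS => ?_
      rw [coneInd, if_pos ((mem_iff S (Finset.mem_powerset.1 (hZQ hS))).2
        (Finset.mem_powerset.1 hS)), mul_one]
    · intro S hS hS'
      rw [coneInd, if_neg, mul_zero]
      rw [mem_iff S (Finset.mem_powerset.1 hS)]
      simpa using hS'
  rw [← Finset.add_sum_erase _ _ (Finset.empty_mem_powerset Q)] at rel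
  simp only [Finset.card_empty, pow_zero, one_smul, Finset.sdiff_empty] at rel
  rw [eq_neg_of_add_eq_zero_left rel]
  refine Submodule.neg_mem _ (Submodule.sum_mem _ fun S hS => Submodule.smul_mem _ _ ?_)
  rw [Finset.mem_erase, Finset.mem_powerset] at hS
  exact Submodule.subset_span ⟨_, indep S hS.2 (Finset.nonempty_iff_ne_empty.2 hS.1), rfl⟩

/-- The indicator function of a finitely generated pointed cone is a combination of indicator
functions of simplicial cones on the same generators. -/
theorem coneInd_mem_span_simplicial [DecidableEq ι] (w : ι → E) (h : E →ₗ[ℝ] ℝ)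
    (hw : ∀ i, h (w i) = 1) (V : Finset ι) :
    coneInd w V ∈ Submodule.span ℚ
      (coneInd w '' {L : Finset ι | LinearIndepOn ℝ w (L : Set ι)}) := by
  classical
  induction V using Finset.induction_on with
  | empty => exact Submodule.subset_span ⟨∅, by simp, rfl⟩
  | insert v V hv ih =>
    obtain ⟨T, hT, c, hc⟩ := (Submodule.mem_span_image_iff_exists_fun ℚ).1 ih
    have ins : ∀ I : Finset ι, LinearIndepOn ℝ w (I : Set ι) →
        coneInd w (insert v I) ∈ Submodule.span ℚ
          (coneInd w '' {L : Finset ι | LinearIndepOn ℝ w (L : Set ι)}) := by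
      intro I hI
      by_cases hvI : v ∈ I
      · rw [Finset.insert_eq_of_mem hvI]
        exact Submodule.subset_span ⟨I, hI, rfl⟩
      · exact coneInd_insert_mem_span w h hw hI hvI
    have hcV : ∀ y, coneInd w V y = ∑ I : T, c I * coneInd w I y := fun y => by
      rw [← hc]
      simp
    have hsum : coneInd w (insert v V) = ∑ I : T, c I • coneInd w (insert v (I : Finset ι)) := by
      ext x
      have := nonempty_eq_sum_of_indicator_eq_sum (Finset.univ : Finset T) c
        (fun I => {s : ℝ | 0 ≤ s ∧ x - s • w v ∈ coneOn w (I : Finset ι)})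
        {s : ℝ | 0 ≤ s ∧ x - s • w v ∈ coneOn w V}
        ⟨isCompact_sweep w h hw V v x, ordConnected_sweep w V (w v) x⟩
        (fun I _ => ⟨isCompact_sweep w h hw I v x, ordConnected_sweep w I (w v) x⟩)
        (fun r => by
          by_cases hr : 0 ≤ r
          · simpa only [coneInd, mem_ofPred_eq, hr, true_and] using hcV (x - r • w v)
          · simp [hr])
      simp only [← mem_coneOn_insert_iff_nonempty] at this
      simpa [coneInd] using this
    rw [hsum]
    exact Submodule.sum_mem _ fun I _ => Submodule.smul_mem _ _ (ins I (hT I.2))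

end Sweep

lemma ncard_sum_eq (κ : Type*) [Fintype κ] (N : ℕ) :
    {k : κ → ℕ | ∑ i, k i = N}.Finite ∧
      {k : κ → ℕ | ∑ i, k i = N}.ncard = (Fintype.card κ + N - 1).choose N := by
  classical
  have e := Sym.equivNatSumOfFintype κ N
  constructor
  · exact Set.finite_coe_iff.1 (Finite.of_equiv _ e)
  · rw [← Sym.card_sym_eq_choose (α := κ) N, ← Nat.card_eq_fintype_card]
    exact (Nat.card_congr e).symm

lemma coe_resMod (p : ℕ) (hp : 0 < p) (t : ℤ) : ((resMod p hp t : ℕ) : ℤ) = t % p := by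
  simp only [resMod]
  exact Int.toNat_of_nonneg (Int.emod_nonneg t (by exact_mod_cast hp.ne'))

/-- The number of solutions in natural numbers of `h + p * ∑ k i = t` is a polynomial in `t`
on each residue class modulo `p`. -/
lemma exists_polynomial_ncard_solutions (κ : Type*) [Fintype κ] (p : ℕ) (hp : 0 < p) (h : ℤ)
    (h0 : 0 ≤ h) (h1 : h ≤ p * Fintype.card κ) (r : Fin p) :
    ∃ q : ℚ[X], q.natDegree ≤ Fintype.card κ - 1 ∧
      ∀ t : ℕ, 1 ≤ t → resMod p hp t = r →
        {k : κ → ℕ | h + p * ∑ i, (k i : ℤ) = t}.Finite ∧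
          ({k : κ → ℕ | h + p * ∑ i, (k i : ℤ) = t}.ncard : ℚ) = q.eval (t : ℚ) := by
  have hp' : (0 : ℤ) < p := by exact_mod_cast hp
  have hdvd : ∀ t : ℕ, resMod p hp t = r → ((p : ℤ) ∣ t - h ↔ (p : ℤ) ∣ (r : ℕ) - h) := by
    rintro t rfl
    rw [coe_resMod]
    have h2 : (p : ℤ) ∣ t - t % p := Int.dvd_self_sub_emod
    constructor
    · intro h3
      have := dvd_sub h3 h2
      simpa using this
    · intro h3
      have := dvd_add h3 h2
      simpa using this
  by_cases hr : (p : ℤ) ∣ (r : ℕ) - h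
  swap
  · refine ⟨0, by simp, fun t _ htr => ?_⟩
    have : {k : κ → ℕ | h + p * ∑ i, (k i : ℤ) = t} = ∅ := by
      ext k
      simp only [mem_ofPred_eq, mem_empty_iff_false, iff_false]
      intro hk
      exact hr ((hdvd t htr).1 ⟨∑ i, (k i : ℤ), by rw [← hk]; ring⟩)
    simp [this]
  obtain hn | hn := Nat.eq_zero_or_pos (Fintype.card κ)
  · refine ⟨0, by simp, fun t ht _ => ?_⟩
    have : {k : κ → ℕ | h + p * ∑ i, (k i : ℤ) = t} = ∅ := by
      ext k
      have := Fintype.card_eq_zero_iff.1 hn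
      simp only [mem_ofPred_eq, mem_empty_iff_false, iff_false]
      rw [hn] at h1
      simp at h1 ⊢
      omega
    simp [this]
  obtain ⟨n, hn⟩ : ∃ n, Fintype.card κ = n + 1 := ⟨_, (Nat.succ_pred_eq_of_pos hn).symm⟩
  refine ⟨C ((n.factorial : ℚ)⁻¹) *
    (descPochhammer ℚ n).comp (C ((p : ℚ)⁻¹) * (X - C (h : ℚ)) + C (n : ℚ)), ?_, ?_⟩
  · refine (natDegree_C_mul_le _ _).trans (natDegree_comp_le.trans ?_)
    rw [descPochhammer_natDegree, hn]
    have : (C ((p : ℚ)⁻¹) * (X - C (h : ℚ)) + C (n : ℚ)).natDegree ≤ 1 := by compute_degree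
    simpa using Nat.mul_le_mul_left n this
  intro t ht htr
  obtain ⟨K, hK⟩ := (hdvd t htr).2 hr
  have hset : {k : κ → ℕ | h + p * ∑ i, (k i : ℤ) = t} = {k | ((∑ i, k i : ℕ) : ℤ) = K} := by
    ext k
    simp only [mem_ofPred_eq, Nat.cast_sum]
    constructor
    · intro hk
      exact mul_left_cancel₀ hp'.ne' (by rw [← hK, ← hk]; ring)
    · intro hk
      rw [hk, ← hK]
      ring
  have hKn : 0 ≤ K + n := by
    by_contra! hc
    have : (p : ℤ) * (K + (n + 1)) ≤ 0 := mul_nonpos_of_nonneg_of_nonpos hp'.le (by omega)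
    rw [hn] at h1
    push_cast at h1
    have : (1 : ℤ) ≤ t := by exact_mod_cast ht
    linarith
  obtain ⟨L, hL⟩ := Int.eq_ofNat_of_zero_le hKn
  have heval : eval (t : ℚ) (C ((n.factorial : ℚ)⁻¹) *
      (descPochhammer ℚ n).comp (C ((p : ℚ)⁻¹) * (X - C (h : ℚ)) + C (n : ℚ))) = L.choose n := by
    have harg : (p : ℚ)⁻¹ * (t - h) + n = (L : ℚ) := by
      have h3 : ((t : ℚ) - h) = p * K := by exact_mod_cast hK
      have h4 : (K : ℚ) + n = L := by exact_mod_cast hL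
      have hp0 : (p : ℚ) ≠ 0 := by exact_mod_cast hp.ne'
      rw [h3, inv_mul_cancel_left₀ hp0, h4]
    simp only [eval_mul, eval_C, eval_comp, eval_add, eval_sub, eval_X]
    rw [harg, descPochhammer_eval_eq_descFactorial, Nat.descFactorial_eq_factorial_mul_choose]
    push_cast
    rw [inv_mul_cancel_left₀ (by exact_mod_cast n.factorial_ne_zero)]
  rw [hset, heval]
  rcases le_or_gt 0 K with hK0 | hK0
  · obtain ⟨N, rfl⟩ := Int.eq_ofNat_of_zero_le hK0
    have hLN : L = N + n := by omega
    simp only [Nat.cast_inj]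
    obtain ⟨hfin, hcard⟩ := ncard_sum_eq κ N
    refine ⟨hfin, ?_⟩
    rw [hcard, hn, hLN, show n + 1 + N - 1 = N + n by omega, ← Nat.choose_symm_add]
  · have : {k : κ → ℕ | ((∑ i, k i : ℕ) : ℤ) = K} = ∅ := by
      ext k
      simp only [mem_ofPred_eq, mem_empty_iff_false, iff_false]
      omega
    rw [this, Nat.choose_eq_zero_of_lt (by omega)]
    simp

/-- The generator of the cone over a polytope attached to an integer vector `a` at height `p`. -/
def lift {d : ℕ} (p : ℕ) (a : Fin d → ℤ) : (Fin d → ℝ) × ℝ := (fun j => (a j : ℝ), (p : ℝ))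

/-- The lattice points at height `t` of the half-open simplicial cone on the vectors
`lift p (a k)`; the facet opposite to the `k`-th generator is included iff `σ k`. -/
def halfOpenSlice {d : ℕ} {κ : Type*} [Fintype κ] (p : ℕ) (a : κ → Fin d → ℤ) (σ : κ → Prop)
    (t : ℝ) : Set (Fin d → ℤ) :=
  {m | ∃ μ : κ → ℝ, (∀ k, 0 ≤ μ k ∧ (0 < μ k ∨ σ k)) ∧
    ∑ k, μ k • lift p (a k) = (fun j => (m j : ℝ), t)}

/-- The lattice points of the half-open fundamental parallelepiped. -/
def halfOpenBox {d : ℕ} {κ : Type*} [Fintype κ] (p : ℕ) (a : κ → Fin d → ℤ) (σ : κ → Prop) :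
    Set ((Fin d → ℤ) × ℤ) :=
  {b | ∃ μ : κ → ℝ, (∀ k, 0 ≤ μ k ∧ μ k ≤ 1 ∧ (0 < μ k ∨ σ k) ∧ (μ k < 1 ∨ ¬ σ k)) ∧
    ∑ k, μ k • lift p (a k) = (fun j => (b.1 j : ℝ), (b.2 : ℝ))}

section HalfOpen

variable {d : ℕ} {κ : Type*} [Fintype κ] (p : ℕ) (a : κ → Fin d → ℤ) (σ : κ → Prop)

lemma sum_lift_eq_iff (μ : κ → ℝ) (x : Fin d → ℝ) (t : ℝ) :
    ∑ k, μ k • lift p (a k) = (x, t) ↔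
      (∀ j, ∑ k, μ k * a k j = x j) ∧ (∑ k, μ k) * p = t := by
  rw [Prod.ext_iff]
  simp only [lift, Prod.fst_sum, Prod.snd_sum, Prod.smul_fst, Prod.smul_snd, smul_eq_mul,
    Finset.sum_mul, funext_iff, Finset.sum_apply, Pi.smul_apply]

lemma halfOpenBox_height {b : (Fin d → ℤ) × ℤ} (hb : b ∈ halfOpenBox p a σ) :
    0 ≤ b.2 ∧ b.2 ≤ p * Fintype.card κ := by
  obtain ⟨μ, hμ, hs⟩ := hb
  have h2 := ((sum_lift_eq_iff p a μ _ _).1 hs).2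
  have h3 : 0 ≤ ∑ k, μ k := Finset.sum_nonneg fun k _ => (hμ k).1
  have h4 : ∑ k, μ k ≤ Fintype.card κ := by
    simpa using Finset.sum_le_sum (s := Finset.univ) fun k _ => (hμ k).2.1
  have hp0 : (0 : ℝ) ≤ p := by positivity
  constructor
  · have : (0 : ℝ) ≤ b.2 := by rw [← h2]; positivity
    exact_mod_cast this
  · have : (b.2 : ℝ) ≤ p * Fintype.card κ := by
      rw [← h2, mul_comm]
      exact mul_le_mul_of_nonneg_left h4 hp0
    exact_mod_cast this

lemma finite_halfOpenBox : (halfOpenBox p a σ).Finite := by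
  apply ((Set.finite_Icc (fun j => -∑ k, |a k j| : Fin d → ℤ) (fun j => ∑ k, |a k j|)).prod
    (Set.finite_Icc (0 : ℤ) (p * Fintype.card κ))).subset
  intro b hb
  have hh := halfOpenBox_height p a σ hb
  obtain ⟨μ, hμ, hs⟩ := hb
  have h2 := ((sum_lift_eq_iff p a μ _ _).1 hs).1
  have habs : ∀ j, |b.1 j| ≤ ∑ k, |a k j| := by
    intro j
    have : |(b.1 j : ℝ)| ≤ ∑ k, |(a k j : ℝ)| := by
      rw [← h2 j]
      refine (Finset.abs_sum_le_sum_abs _ _).trans (Finset.sum_le_sum fun k _ => ?_)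
      rw [abs_mul, abs_of_nonneg (hμ k).1]
      exact mul_le_of_le_one_left (abs_nonneg _) (hμ k).2.1
    exact_mod_cast this
  exact ⟨⟨fun j => (abs_le.1 (habs j)).1, fun j => (abs_le.1 (habs j)).2⟩, hh⟩

/-- Splitting a nonnegative real into a natural number and a remainder in a half-open unit
interval. -/
lemma exists_nat_add_halfOpen {x : ℝ} {s : Prop} (hx : 0 ≤ x ∧ (0 < x ∨ s)) :
    ∃ n : ℕ, 0 ≤ x - n ∧ x - n ≤ 1 ∧ (0 < x - n ∨ s) ∧ (x - n < 1 ∨ ¬ s) := by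
  by_cases hs : s
  · refine ⟨⌊x⌋₊, ?_⟩
    have h1 := Nat.floor_le hx.1
    have h2 := Nat.lt_floor_add_one x
    exact ⟨by linarith, by linarith, Or.inr hs, Or.inl (by linarith)⟩
  · have hpos : 0 < x := hx.2.resolve_right hs
    have h0 : 0 < ⌈x⌉₊ := Nat.ceil_pos.2 hpos
    refine ⟨⌈x⌉₊ - 1, ?_⟩
    have h1 := Nat.le_ceil x
    have h2 := Nat.ceil_lt_add_one hx.1
    rw [Nat.cast_sub h0, Nat.cast_one]
    exact ⟨by linarith, by linarith, Or.inl (by linarith), Or.inr hs⟩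

lemma nat_eq_of_halfOpen {x y : ℝ} {m n : ℕ} {s : Prop}
    (hx : 0 ≤ x ∧ x ≤ 1 ∧ (0 < x ∨ s) ∧ (x < 1 ∨ ¬ s))
    (hy : 0 ≤ y ∧ y ≤ 1 ∧ (0 < y ∨ s) ∧ (y < 1 ∨ ¬ s)) (h : x + m = y + n) : m = n := by
  have h1 : (m : ℝ) < n + 1 := by
    by_cases hs : s
    · have := hy.2.2.2.resolve_right (not_not.2 hs)
      linarith [hx.1]
    · have := hx.2.2.1.resolve_right hs
      linarith [hy.2.1]
  have h2 : (n : ℝ) < m + 1 := by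
    by_cases hs : s
    · have := hx.2.2.2.resolve_right (not_not.2 hs)
      linarith [hy.1]
    · have := hy.2.2.1.resolve_right hs
      linarith [hx.2.1]
  have h1' : m < n + 1 := by exact_mod_cast h1
  have h2' : n < m + 1 := by exact_mod_cast h2
  omega

lemma bijOn_halfOpenSlice (hlin : LinearIndependent ℝ fun k => lift p (a k)) (t : ℕ) :
    BijOn (fun z : Σ _ : (Fin d → ℤ) × ℤ, κ → ℕ => fun j => z.1.1 j + ∑ k, (z.2 k : ℤ) * a k j)
      ((halfOpenBox p a σ).sigma fun b => {k : κ → ℕ | b.2 + p * ∑ i, (k i : ℤ) = t})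
      (halfOpenSlice p a σ t) := by
  have split : ∀ (b : (Fin d → ℤ) × ℤ) (k : κ → ℕ) (μ : κ → ℝ), b.2 + p * ∑ i, (k i : ℤ) = t →
      ∑ i, μ i • lift p (a i) = (fun j => (b.1 j : ℝ), (b.2 : ℝ)) →
      ∑ i, (μ i + k i) • lift p (a i) =
        (fun j => ((b.1 j + ∑ i, (k i : ℤ) * a i j : ℤ) : ℝ), (t : ℝ)) := by
    intro b k μ hk hμ
    rw [sum_lift_eq_iff] at hμ ⊢
    constructor
    · intro j
      simp only [add_mul, Finset.sum_add_distrib, hμ.1]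
      push_cast
      rfl
    · rw [Finset.sum_add_distrib, add_mul, hμ.2]
      have : (b.2 : ℝ) + p * ∑ i, (k i : ℝ) = t := by exact_mod_cast hk
      linarith
  refine ⟨?_, ?_, ?_⟩
  · rintro ⟨b, k⟩ ⟨⟨μ, hμ, hs⟩, hk⟩
    refine ⟨fun i => μ i + k i, fun i => ⟨?_, ?_⟩, split b k μ hk hs⟩
    · have := (hμ i).1
      positivity
    · rcases (hμ i).2.2.1 with h | h
      · exact Or.inl (by positivity)
      · exact Or.inr h
  · rintro ⟨b, k⟩ ⟨⟨μ, hμ, hs⟩, hk⟩ ⟨b', k'⟩ ⟨⟨μ', hμ', hs'⟩, hk'⟩ heq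
    have heq' : ∀ j, b.1 j + ∑ i, (k i : ℤ) * a i j = b'.1 j + ∑ i, (k' i : ℤ) * a i j :=
      fun j => congrFun heq j
    have e1 := split b k μ hk hs
    have e2 := split b' k' μ' hk' hs'
    simp only [heq'] at e1
    have hco : ∀ i, μ i + k i = μ' i + k' i := by
      have h0 : ∑ i, ((μ i + k i) - (μ' i + k' i)) • lift p (a i) = 0 := by
        simp only [sub_smul _ (μ' _ + _), Finset.sum_sub_distrib, e1, e2, sub_self]
      intro i
      have := Fintype.linearIndependent_iff.1 hlin _ h0 i
      linarith
    have hkk : k = k' := funext fun i => nat_eq_of_halfOpen (hμ i) (hμ' i) (hco i)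
    subst hkk
    have hb : b = b' := by
      refine Prod.ext (funext fun j => by simpa using heq' j) ?_
      have h1 : b.2 + p * ∑ i, (k i : ℤ) = t := hk
      have h2 : b'.2 + p * ∑ i, (k i : ℤ) = t := hk'
      linarith
    rw [hb]
  · rintro m ⟨μ, hμ, hs⟩
    choose k hk using fun i => exists_nat_add_halfOpen (hμ i)
    refine ⟨⟨(fun j => m j - ∑ i, (k i : ℤ) * a i j, t - p * ∑ i, (k i : ℤ)), k⟩,
      ⟨⟨fun i => μ i - k i, hk, ?_⟩, ?_⟩, ?_⟩
    · rw [sum_lift_eq_iff] at hs ⊢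
      constructor
      · intro j
        simp only [sub_mul, Finset.sum_sub_distrib, hs.1]
        push_cast
        rfl
      · rw [Finset.sum_sub_distrib, sub_mul, hs.2]
        push_cast
        ring
    · simp
    · ext j
      simp

open Classical in
lemma finite_sigma_and_ncard {α β : Type*} {A : Set α} (hA : A.Finite) {B : α → Set β}
    (hB : ∀ a ∈ A, (B a).Finite) :
    (A.sigma B).Finite ∧ (A.sigma B).ncard = ∑ a ∈ hA.toFinset, (B a).ncard := by
  let F : α → Finset β := fun a => if h : (B a).Finite then h.toFinset else ∅
  have hF : ∀ a ∈ A, (F a : Set β) = B a := fun a ha => by simp [F, hB a ha]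
  have h : A.sigma B = (hA.toFinset.sigma F : Set (Σ _ : α, β)) := by
    ext ⟨a, b⟩
    simp only [mem_sigma_iff, Finset.coe_sigma, Finite.coe_toFinset]
    exact and_congr_right fun ha => by rw [hF a ha]
  rw [h, Set.ncard_coe_finset, Finset.card_sigma]
  refine ⟨Finset.finite_toSet _, Finset.sum_congr rfl fun a ha => ?_⟩
  rw [← hF a (hA.mem_toFinset.1 ha), Set.ncard_coe_finset]

/-- Ehrhart quasi-polynomiality for half-open simplicial cones. -/
lemma exists_quasipolynomial_halfOpenSlice (hp : 0 < p)
    (hlin : LinearIndependent ℝ fun k => lift p (a k)) :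
    ∃ q : Fin p → ℚ[X], (∀ i, (q i).natDegree ≤ d) ∧ ∀ t : ℕ, 1 ≤ t →
      (halfOpenSlice p a σ t).Finite ∧
        ((halfOpenSlice p a σ t).ncard : ℚ) = (q (resMod p hp t)).eval (t : ℚ) := by
  have hcard : Fintype.card κ - 1 ≤ d := by
    have := hlin.fintype_card_le_finrank
    simp at this
    omega
  have hfin := finite_halfOpenBox p a σ
  have hpoly := fun (b : halfOpenBox p a σ) (r : Fin p) =>
    exists_polynomial_ncard_solutions κ p hp b.1.2 (halfOpenBox_height p a σ b.2).1
      (halfOpenBox_height p a σ b.2).2 r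
  choose Q hQdeg hQ using hpoly
  have := hfin.fintype
  refine ⟨fun r => ∑ b, Q b r, fun r => ?_, fun t ht => ?_⟩
  · exact natDegree_sum_le_of_forall_le _ _ fun b _ => (hQdeg b r).trans hcard
  have hbij := bijOn_halfOpenSlice p a σ hlin t
  have hsig := finite_sigma_and_ncard hfin
    (B := fun b => {k : κ → ℕ | b.2 + p * ∑ i, (k i : ℤ) = t})
    fun b hb => (hQ ⟨b, hb⟩ _ t ht rfl).1
  refine ⟨hbij.image_eq ▸ hsig.1.image _, ?_⟩
  rw [← hbij.ncard_eq, eval_finsetSum, hsig.2, Nat.cast_sum]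
  rw [Finset.sum_subtype hfin.toFinset (p := (· ∈ halfOpenBox p a σ))
    (fun b => hfin.mem_toFinset)]
  exact Finset.sum_congr rfl fun b _ => (hQ b _ t ht rfl).2

end HalfOpen

lemma mem_DSet_iff {d : ℕ} {u : Fin d → ℝ} {A : Set (Fin d → ℝ)} {m : Fin d → ℤ} :
    m ∈ DSet d u A ↔ ∀ᶠ ε in 𝓝[>] (0 : ℝ), (fun i => (m i : ℝ)) + ε • u ∈ A := by
  rw [Filter.Eventually, mem_nhdsGT_iff_exists_Ioc_subset]
  exact ⟨fun ⟨e, he, h⟩ => ⟨e, he, fun ε hε => h ε hε.1 hε.2⟩,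
    fun ⟨e, he, h⟩ => ⟨e, he, fun ε h1 h2 => h ⟨h1, h2⟩⟩⟩

/-- The lattice-point sums of the limit of `f` in direction `u` at the heights `t ≥ 1` form a
quasi-polynomial of degree at most `d` and period dividing `p`. -/
def IsDirectionallyQuasipolynomial {d : ℕ} (p : ℕ) (hp : 0 < p) (u : Fin d → ℝ)
    (f : (Fin d → ℝ) × ℝ → ℚ) : Prop :=
  ∃ q : Fin p → ℚ[X], (∀ i, (q i).natDegree ≤ d) ∧ ∀ t : ℕ, 1 ≤ t →
    ∃ g : (Fin d → ℤ) → ℚ,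
      (∀ m : Fin d → ℤ, ∀ᶠ ε in 𝓝[>] (0 : ℝ), f ((fun j => (m j : ℝ)) + ε • u, (t : ℝ)) = g m) ∧
      g.support.Finite ∧ ∑ᶠ m, g m = (q (resMod p hp t)).eval (t : ℚ)

namespace IsDirectionallyQuasipolynomial

variable {d p : ℕ} {hp : 0 < p} {u : Fin d → ℝ} {f f' : (Fin d → ℝ) × ℝ → ℚ}

lemma zero : IsDirectionallyQuasipolynomial p hp u 0 :=
  ⟨0, by simp, fun t _ => ⟨0, by simp, by simp, by simp⟩⟩

lemma add (h : IsDirectionallyQuasipolynomial p hp u f)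
    (h' : IsDirectionallyQuasipolynomial p hp u f') :
    IsDirectionallyQuasipolynomial p hp u (f + f') := by
  obtain ⟨q, hq, H⟩ := h
  obtain ⟨q', hq', H'⟩ := h'
  refine ⟨q + q', fun i => natDegree_add_le_of_degree_le (hq i) (hq' i), fun t ht => ?_⟩
  obtain ⟨g, hg, hf, hs⟩ := H t ht
  obtain ⟨g', hg', hf', hs'⟩ := H' t ht
  refine ⟨g + g', fun m => ?_, (hf.union hf').subset (Function.support_add _ _), ?_⟩
  · filter_upwards [hg m, hg' m] with ε h1 h2
    simp [h1, h2]
  · simp only [Pi.add_apply, eval_add]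
    rw [finsum_add_distrib hf hf', hs, hs']

lemma smul (c : ℚ) (h : IsDirectionallyQuasipolynomial p hp u f) :
    IsDirectionallyQuasipolynomial p hp u (c • f) := by
  obtain ⟨q, hq, H⟩ := h
  refine ⟨c • q, fun i => (natDegree_smul_le _ _).trans (hq i), fun t ht => ?_⟩
  obtain ⟨g, hg, hf, hs⟩ := H t ht
  refine ⟨c • g, fun m => ?_, hf.subset (Function.support_const_smul_subset _ _), ?_⟩
  · filter_upwards [hg m] with ε h1
    simp [h1]
  · simp only [Pi.smul_apply, eval_smul]
    rw [← smul_finsum, hs]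

end IsDirectionallyQuasipolynomial

lemma mem_coneOn_iff_subtype {ι E : Type*} [AddCommGroup E] [Module ℝ E] (w : ι → E)
    (I : Finset ι) (x : E) :
    x ∈ coneOn w I ↔ ∃ μ : I → ℝ, (∀ k, 0 ≤ μ k) ∧ ∑ k : I, μ k • w k = x := by
  classical
  constructor
  · rintro ⟨μ, hμ, rfl⟩
    exact ⟨fun k => μ k, fun k => hμ k k.2, Finset.sum_coe_sort I fun i => μ i • w i⟩
  · rintro ⟨μ, hμ, rfl⟩
    refine ⟨fun i => if hi : i ∈ I then μ ⟨i, hi⟩ else 0, fun i hi => by simp [hi, hμ], ?_⟩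
    rw [← Finset.sum_coe_sort]
    simp

lemma eventually_nonneg_add_mul_iff (x c : ℝ) :
    ∀ᶠ ε in 𝓝[>] (0 : ℝ), (0 ≤ x + ε * c ↔ 0 ≤ x ∧ (0 < x ∨ 0 ≤ c)) := by
  have hlim : Tendsto (fun ε : ℝ => x + ε * c) (𝓝[>] 0) (𝓝 x) := by
    have : Tendsto (fun ε : ℝ => x + ε * c) (𝓝 0) (𝓝 (x + 0 * c)) :=
      (by fun_prop : Continuous fun ε : ℝ => x + ε * c).tendsto 0
    rw [zero_mul, add_zero] at this
    exact this.mono_left nhdsWithin_le_nhds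
  rcases lt_trichotomy x 0 with hx | rfl | hx
  · filter_upwards [hlim.eventually (gt_mem_nhds hx)] with ε hε
    exact iff_of_false (not_le.2 hε) fun h => absurd h.1 (not_le.2 hx)
  · filter_upwards [self_mem_nhdsWithin] with ε hε
    have : (0 : ℝ) < ε := hε
    simp [this]
  · filter_upwards [hlim.eventually (lt_mem_nhds hx)] with ε hε
    exact iff_of_true hε.le ⟨hx.le, Or.inl hx⟩

open Classical in
lemma isDirectionallyQuasipolynomial_coneInd {ι : Type*} {d p : ℕ} (hp : 0 < p) (u : Fin d → ℝ)
    (a : ι → Fin d → ℤ) {I : Finset ι}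
    (hI : LinearIndepOn ℝ (fun i => lift p (a i)) (I : Set ι)) :
    IsDirectionallyQuasipolynomial p hp u (coneInd (fun i => lift p (a i)) I) := by
  have hlin : LinearIndependent ℝ fun k : I => lift p (a k) := hI
  have hadd : ∀ (m : Fin d → ℤ) (t ε : ℝ), (((fun j => (m j : ℝ)) + ε • u, t) : (Fin d → ℝ) × ℝ) =
      (fun j => (m j : ℝ), t) + ε • (u, 0) := fun m t ε => by simp
  by_cases hu : ∃ c : I → ℝ, ∑ k, c k • lift p (a k) = (u, 0)
  · obtain ⟨c, hc⟩ := hu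
    obtain ⟨q, hq, H⟩ := exists_quasipolynomial_halfOpenSlice p (fun k : I => a k)
      (fun k => 0 ≤ c k) hp hlin
    refine ⟨q, hq, fun t ht => ?_⟩
    obtain ⟨hfin, hcard⟩ := H t ht
    set S := halfOpenSlice p (fun k : I => a k) (fun k => 0 ≤ c k) t
    refine ⟨S.indicator 1, fun m => ?_, hfin.subset Set.support_indicator_subset, ?_⟩
    · by_cases hm : ∃ μ : I → ℝ, ∑ k, μ k • lift p (a k) = (fun j => (m j : ℝ), (t : ℝ))
      · obtain ⟨μ, hμ⟩ := hm
        have hev := Filter.eventually_all.2 fun k => eventually_nonneg_add_mul_iff (μ k) (c k)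
        have hmS : m ∈ S ↔ ∀ k, 0 ≤ μ k ∧ (0 < μ k ∨ 0 ≤ c k) := by
          constructor
          · rintro ⟨ν, hν, hs⟩
            have : ν = μ := by
              funext k
              have h0 : ∑ k, (ν k - μ k) • lift p (a k) = 0 := by
                have hs' : ∑ k, ν k • lift p (a k) = (fun j => (m j : ℝ), (t : ℝ)) := hs
                simp only [sub_smul, Finset.sum_sub_distrib, hs', hμ, sub_self]
              linarith [Fintype.linearIndependent_iff.1 hlin _ h0 k]
            exact this ▸ hν
          · exact fun h => ⟨μ, h, hμ⟩
        filter_upwards [hev] with ε hε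
        have hsum : ∑ k, (μ k + ε * c k) • lift p (a k) =
            (fun j => (m j : ℝ), (t : ℝ)) + ε • (u, 0) := by
          simp only [add_smul, mul_smul, Finset.sum_add_distrib, ← Finset.smul_sum, hμ, hc]
        have hmem : ((fun j => (m j : ℝ)) + ε • u, (t : ℝ)) ∈ coneOn (fun i => lift p (a i)) I ↔
            m ∈ S := by
          rw [hmS, hadd, mem_coneOn_iff_subtype]
          simp only [← hε]
          constructor
          · rintro ⟨ν, hν, hs⟩ k
            have h0 : ∑ k, (ν k - (μ k + ε * c k)) • lift p (a k) = 0 := by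
              simp only [sub_smul, Finset.sum_sub_distrib, hs, hsum, sub_self]
            have := Fintype.linearIndependent_iff.1 hlin _ h0 k
            linarith [hν k]
          · exact fun h => ⟨_, h, hsum⟩
        simp [coneInd, hmem, Set.indicator_apply]
      · have hmS : m ∉ S := fun ⟨μ, _, hs⟩ => hm ⟨μ, hs⟩
        refine Filter.Eventually.of_forall fun ε => ?_
        have : ((fun j => (m j : ℝ)) + ε • u, (t : ℝ)) ∉ coneOn (fun i => lift p (a i)) I := by
          rw [hadd, mem_coneOn_iff_subtype]
          rintro ⟨ν, _, hs⟩
          refine hm ⟨fun k => ν k - ε * c k, ?_⟩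
          simp only [sub_smul, mul_smul, Finset.sum_sub_distrib, ← Finset.smul_sum, hs, hc]
          simp
        simp [coneInd, this, hmS]
    · rw [← hcard, finsum_eq_sum_of_support_subset _ (s := hfin.toFinset) (by simp),
        Set.ncard_eq_toFinset_card S hfin, Finset.cast_card]
      exact Finset.sum_congr rfl fun m hm => by simp [hfin.mem_toFinset.1 hm]
  · refine ⟨0, by simp, fun t _ => ⟨0, fun m => ?_, by simp, by simp⟩⟩
    set K := {ε : ℝ | ((fun j => (m j : ℝ)) + ε • u, (t : ℝ)) ∈ coneOn (fun i => lift p (a i)) I}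
    have hsub : K.Subsingleton := by
      intro ε hε ε' hε'
      by_contra hne
      simp only [K, mem_ofPred_eq, hadd, mem_coneOn_iff_subtype] at hε hε'
      obtain ⟨μ, -, h1⟩ := hε
      obtain ⟨ν, -, h2⟩ := hε'
      refine hu ⟨fun k => (ε - ε')⁻¹ * (μ k - ν k), ?_⟩
      simp only [mul_smul, sub_smul, ← Finset.smul_sum, Finset.sum_sub_distrib, h1, h2]
      rw [add_sub_add_left_eq_sub, ← sub_smul, inv_smul_smul₀ (sub_ne_zero.2 hne)]
    have hnot : ∀ᶠ ε in 𝓝[>] (0 : ℝ), ε ∉ K := by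
      have h1 : ∀ᶠ ε in 𝓝[>] (0 : ℝ), ε ∉ K \ {0} := by
        have hcl : IsClosed (K \ {0}) := (hsub.anti Set.sdiff_subset).finite.isClosed
        exact nhdsWithin_le_nhds (hcl.isOpen_compl.mem_nhds (by simp))
      filter_upwards [h1, self_mem_nhdsWithin] with ε h2 h3 h4
      exact h2 ⟨h4, (ne_of_gt h3)⟩
    filter_upwards [hnot] with ε hε
    exact if_neg hε

/-- Dilates of a polytope as height slices of the cone over it. -/
lemma mem_smul_convexHull_iff {d p : ℕ} (hp : 0 < p) (V : Finset (Fin d → ℝ)) (a : V → Fin d → ℤ)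
    (ha : ∀ v : V, ∀ i, (p : ℝ) * v.1 i = a v i) {t : ℝ} (ht : 0 < t) (x : Fin d → ℝ) :
    x ∈ t • convexHull ℝ (V : Set (Fin d → ℝ)) ↔
      (x, t) ∈ coneOn (fun v => lift p (a v)) (Finset.univ : Finset V) := by
  have hp' : (0 : ℝ) < p := by exact_mod_cast hp
  rw [mem_smul_set_iff_inv_smul_mem₀ ht.ne', Finset.mem_convexHull']
  constructor
  · rintro ⟨μ, hμ, h1, h2⟩
    refine ⟨fun v => t * μ v / p, fun v _ => ?_, ?_⟩
    · have := hμ v v.2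
      positivity
    · rw [sum_lift_eq_iff]
      have h1' : ∑ v : V, μ v = 1 := by rw [← h1, Finset.sum_coe_sort V μ]
      constructor
      · intro j
        have h3 := congrFun h2 j
        rw [← Finset.sum_coe_sort] at h3
        simp only [Finset.sum_apply, Pi.smul_apply, smul_eq_mul] at h3
        calc ∑ v : V, t * μ v / p * a v j = t * ∑ v : V, μ v * v.1 j := by
              rw [Finset.mul_sum]
              refine Finset.sum_congr rfl fun v _ => ?_
              rw [← ha v j]
              field_simp
          _ = x j := by rw [h3, mul_inv_cancel_left₀ ht.ne']
      · rw [← Finset.sum_div, ← Finset.mul_sum, h1']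
        field_simp
  · rintro ⟨μ, hμ, hs⟩
    rw [sum_lift_eq_iff] at hs
    refine ⟨fun v => if hv : v ∈ V then t⁻¹ * (p * μ ⟨v, hv⟩) else 0, fun v hv => ?_, ?_, ?_⟩
    · have := hμ ⟨v, hv⟩ (Finset.mem_univ _)
      simp only [hv, dite_true]
      positivity
    · rw [← Finset.sum_coe_sort]
      simp only [Finset.coe_mem, dite_true, Subtype.coe_eta, ← Finset.mul_sum]
      rw [mul_comm (p : ℝ), hs.2, inv_mul_cancel₀ ht.ne']
    · rw [← Finset.sum_coe_sort]
      ext j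
      simp only [Finset.coe_mem, dite_true, Subtype.coe_eta, Finset.sum_apply, Pi.smul_apply,
        smul_eq_mul, ← hs.1 j, Finset.mul_sum, ← ha]
      exact Finset.sum_congr rfl fun v _ => by ring

/-- The upper bound on the degree: `DSet` counts are quasi-polynomial. -/
lemma exists_quasipolynomial_ncard_DSet {d p : ℕ} (hp : 0 < p) (V : Finset (Fin d → ℝ))
    (u : Fin d → ℝ) (hpV : ∀ v ∈ V, ∀ i, ∃ n : ℤ, (p : ℝ) * v i = (n : ℝ)) :
    ∃ q : Fin p → ℚ[X], (∀ i, (q i).natDegree ≤ d) ∧ ∀ t : ℕ, 1 ≤ t →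
      (DSet d u ((t : ℝ) • convexHull ℝ (V : Set (Fin d → ℝ)))).Finite ∧
      ((DSet d u ((t : ℝ) • convexHull ℝ (V : Set (Fin d → ℝ)))).ncard : ℚ) =
        (q (resMod p hp t)).eval (t : ℚ) := by
  classical
  choose a ha using fun v : V => hpV v.1 v.2
  have hp' : (p : ℝ) ≠ 0 := by exact_mod_cast hp.ne'
  have hspan := coneInd_mem_span_simplicial (fun v => lift p (a v))
    ((p : ℝ)⁻¹ • LinearMap.snd ℝ (Fin d → ℝ) ℝ) (fun v => by simp [lift, hp'])
    (Finset.univ : Finset V)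
  have hquasi : ∀ f ∈ Submodule.span ℚ (coneInd (fun v => lift p (a v)) ''
      {L : Finset V | LinearIndepOn ℝ (fun v => lift p (a v)) (L : Set V)}),
      IsDirectionallyQuasipolynomial p hp u f := by
    intro f hf
    induction hf using Submodule.span_induction with
    | mem f hf =>
      obtain ⟨I, hI, rfl⟩ := hf
      exact isDirectionallyQuasipolynomial_coneInd hp u a hI
    | zero => exact .zero
    | add f f' _ _ h h' => exact h.add h'
    | smul c f _ h => exact h.smul c
  obtain ⟨q, hq, H⟩ := hquasi _ hspan
  refine ⟨q, hq, fun t ht => ?_⟩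
  obtain ⟨g, hg, hf, hs⟩ := H t ht
  set S := DSet d u ((t : ℝ) • convexHull ℝ (V : Set (Fin d → ℝ)))
  have hgS : g = S.indicator 1 := by
    ext m
    have hmem : ∀ ε : ℝ, (fun j => (m j : ℝ)) + ε • u ∈ (t : ℝ) • convexHull ℝ (V : Set _) ↔
        ((fun j => (m j : ℝ)) + ε • u, (t : ℝ)) ∈
          coneOn (fun v => lift p (a v)) (Finset.univ : Finset V) := fun ε =>
      mem_smul_convexHull_iff hp V a ha (by exact_mod_cast ht) _
    by_cases hm : m ∈ S
    · obtain ⟨ε, h1, h2⟩ := ((hg m).and (mem_DSet_iff.1 hm)).exists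
      rw [coneInd, if_pos ((hmem ε).1 h2)] at h1
      simp [hm, ← h1]
    · rw [Set.indicator_of_notMem hm]
      by_contra hne
      refine hm (mem_DSet_iff.2 ?_)
      filter_upwards [hg m] with ε h1
      rw [hmem]
      by_contra h2
      rw [coneInd, if_neg h2] at h1
      exact hne h1.symm
  have hSfin : S.Finite := by
    refine hf.subset fun m hm => ?_
    simp [hgS, hm]
  refine ⟨hSfin, ?_⟩
  rw [← hs, hgS, finsum_eq_sum_of_support_subset _ (s := hSfin.toFinset) (by simp),
    Set.ncard_eq_toFinset_card S hSfin, Finset.cast_card]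
  exact Finset.sum_congr rfl fun m hm => by simp [hSfin.mem_toFinset.1 hm]

/-- A set with nonempty interior has `DSet` counts growing at least like the `d`-th power of the
dilation factor. -/
lemma exists_pow_le_ncard_DSet {d p : ℕ} (hp : 0 < p) {P : Set (Fin d → ℝ)} (u : Fin d → ℝ)
    (hint : (interior P).Nonempty) :
    ∃ N : ℕ, 0 < N ∧ ∀ j : ℕ, 1 ≤ j → (DSet d u (((p * N * j : ℕ) : ℝ) • P)).Finite →
      j ^ d ≤ (DSet d u (((p * N * j : ℕ) : ℝ) • P)).ncard := by
  obtain ⟨x, hx⟩ := hint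
  obtain ⟨r, hr, hball⟩ := Metric.mem_nhds_iff.1 (mem_interior_iff_mem_nhds.1 hx)
  obtain ⟨N, hN⟩ := exists_nat_gt r⁻¹
  have hNr : 1 < N * r := by rwa [inv_lt_iff_one_lt_mul₀ hr] at hN
  have hN0 : 0 < N := by
    rcases Nat.eq_zero_or_pos N with rfl | h
    · norm_num at hNr
    · exact h
  refine ⟨N, hN0, fun j hj hfin => ?_⟩
  set T : ℕ := p * N * j
  set t : ℝ := (T : ℝ) with ht
  have hT : N * j ≤ T := by
    rw [show T = p * (N * j) by simp only [T]; ring]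
    exact Nat.le_mul_of_pos_left _ hp
  have hj' : (1 : ℝ) ≤ j := by exact_mod_cast hj
  have htr : (j : ℝ) < t * r := by
    have h1 : ((N : ℝ) * j) ≤ t := by rw [ht]; exact_mod_cast hT
    nlinarith [mul_le_mul_of_nonneg_right h1 hr.le]
  have ht0 : 0 < t := pos_of_mul_pos_left (by linarith) hr.le
  let φ : (Fin d → Fin j) → Fin d → ℤ := fun k i => ⌊t * x i⌋ + (k i : ℕ)
  have hφ : ∀ k, φ k ∈ DSet d u (t • P) := by
    intro k
    rw [mem_DSet_iff]
    have hcont : Continuous fun ε : ℝ => t⁻¹ • ((fun i => (φ k i : ℝ)) + ε • u) := by fun_prop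
    have h0 : t⁻¹ • ((fun i => (φ k i : ℝ)) + (0 : ℝ) • u) ∈ Metric.ball x r := by
      rw [Metric.mem_ball, dist_pi_lt_iff hr]
      intro i
      have h1 := Int.floor_le (t * x i)
      have h2 := Int.lt_floor_add_one (t * x i)
      have h3 : ((k i : ℕ) : ℝ) + 1 ≤ j := by exact_mod_cast (k i).2
      have h4 : (0 : ℝ) ≤ ((k i : ℕ) : ℝ) := by positivity
      have h5 : |(φ k i : ℝ) - t * x i| < t * r := by
        simp only [φ]
        push_cast
        rw [abs_lt]
        constructor <;> linarith
      have h6 : t⁻¹ * (φ k i : ℝ) - x i = t⁻¹ * ((φ k i : ℝ) - t * x i) := by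
        field_simp
      simp only [zero_smul, add_zero, Pi.smul_apply, smul_eq_mul, Real.dist_eq]
      rw [h6, abs_mul, abs_of_pos (inv_pos.2 ht0), inv_mul_lt_iff₀ ht0]
      exact h5
    have hev := (hcont.tendsto 0).eventually (Metric.isOpen_ball.mem_nhds h0)
    filter_upwards [nhdsWithin_le_nhds hev] with ε hε
    rw [mem_smul_set_iff_inv_smul_mem₀ ht0.ne']
    exact hball hε
  have hinj : Function.Injective φ := by
    intro k k' h
    funext i
    have := congrFun h i
    simp only [φ, add_right_inj, Nat.cast_inj] at this
    exact Fin.ext this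
  calc j ^ d = (Set.range φ).ncard := by
        rw [← Set.image_univ, hinj.injOn.ncard_image, Set.ncard_univ]
        simp
    _ ≤ _ := Set.ncard_le_ncard (Set.range_subset_iff.2 hφ) hfin

/-- A polynomial which is at least `j ^ d` at the points `c * j` has degree at least `d`. -/
lemma le_natDegree_of_pow_le {d : ℕ} (q : ℚ[X]) (c : ℚ)
    (h : ∀ j : ℕ, 1 ≤ j → (j : ℚ) ^ d ≤ q.eval (c * j)) : d ≤ q.natDegree := by
  by_contra! hlt
  have hdeg : (q.comp (C c * X)).degree < (X ^ d : ℚ[X]).degree := by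
    rw [degree_X_pow]
    refine lt_of_le_of_lt degree_le_natDegree ?_
    have h1 : (q.comp (C c * X)).natDegree ≤ q.natDegree * (C c * X).natDegree :=
      natDegree_comp_le
    have h2 : (C c * X : ℚ[X]).natDegree ≤ 1 := by compute_degree
    have h3 := Nat.mul_le_mul_left q.natDegree h2
    exact_mod_cast (by omega : (q.comp (C c * X)).natDegree < d)
  have hlim := (Polynomial.div_tendsto_atTop_zero_of_degree_lt _ _ hdeg).comp
    (tendsto_natCast_atTop_atTop (R := ℚ))
  obtain ⟨j, h1, h2⟩ :=
    ((hlim.eventually (gt_mem_nhds one_pos)).and (eventually_ge_atTop 1)).exists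
  have hj : (0 : ℚ) < (j : ℚ) ^ d := by
    have : (0 : ℚ) < j := by exact_mod_cast h2
    positivity
  simp only [Function.comp_apply, eval_comp, eval_mul, eval_C, eval_X, eval_pow,
    div_lt_one hj] at h1
  exact absurd (h j h2) (not_le.2 h1)

lemma exists_quasipolynomial_ncard_DSet_degree {d p : ℕ} (hd : 1 ≤ d) (hp : 0 < p)
    (V : Finset (Fin d → ℝ)) (u : Fin d → ℝ)
    (hint : (interior (convexHull ℝ (V : Set (Fin d → ℝ)))).Nonempty)
    (hpV : ∀ v ∈ V, ∀ i, ∃ n : ℤ, (p : ℝ) * v i = (n : ℝ)) :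
    ∃ q : Fin p → ℚ[X], ((∀ i, (q i).degree ≤ (d : ℕ)) ∧ ∃ i, (q i).degree = (d : ℕ)) ∧
      ∀ t : ℕ, 1 ≤ t →
        ((DSet d u ((t : ℝ) • convexHull ℝ (V : Set (Fin d → ℝ)))).ncard : ℚ) =
          (q (resMod p hp t)).eval (t : ℚ) := by
  obtain ⟨q, hq, H⟩ := exists_quasipolynomial_ncard_DSet hp V u hpV
  refine ⟨q, ⟨fun i => natDegree_le_iff_degree_le.1 (hq i), resMod p hp 0, ?_⟩,
    fun t ht => (H t ht).2⟩
  obtain ⟨N, hN, hlow⟩ := exists_pow_le_ncard_DSet hp u hint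
  have hle : d ≤ (q (resMod p hp 0)).natDegree := by
    refine le_natDegree_of_pow_le _ ((p * N : ℕ) : ℚ) fun j hj => ?_
    have hT : 1 ≤ p * N * j := Nat.mul_pos (Nat.mul_pos hp hN) hj
    have hres : resMod p hp ((p * N * j : ℕ) : ℤ) = resMod p hp 0 := by
      simp [resMod, mul_assoc]
    have h1 := (H _ hT).2
    rw [hres] at h1
    rw [← Nat.cast_mul, ← h1]
    exact_mod_cast hlow j hj (H _ hT).1
  exact (degree_eq_iff_natDegree_eq_of_pos hd).2 (le_antisymm (hq _) hle)

/-- For a rational `d`-polytope `P` with denominator `p` and a fixed vector `u ∈ ℝ^d`,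
the counting function `D_{P,u}(t) = #{m ∈ ℤ^d : m + ε·u ∈ tP for all small ε > 0}` is a
quasi-polynomial of degree `d` whose period divides `p`; in particular, if all vertices
of `P` are integral then `D_{P,u}` agrees with a single polynomial of degree `d` on
positive integers. -/
theorem directional_count_quasipolynomial
    (d : ℕ) (hd : 1 ≤ d)
    (V : Finset (Fin d → ℝ)) (P : Set (Fin d → ℝ))
    (u : Fin d → ℝ)
    -- `P` is the convex hull of the finite set `V` of rational points
    (hP : P = convexHull ℝ (V : Set (Fin d → ℝ)))
    (hrat : ∀ v ∈ V, ∀ i, ∃ q : ℚ, v i = (q : ℝ))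
    -- `V` is exactly the vertex set of `P`
    (hvert : (V : Set (Fin d → ℝ)) = Set.extremePoints ℝ P)
    -- `P` is full-dimensional
    (hint : (interior P).Nonempty)
    -- `p` is the denominator of `P`
    (p : ℕ) (hp : 0 < p)
    (hpV : ∀ v ∈ V, ∀ i, ∃ n : ℤ, (p : ℝ) * v i = (n : ℝ))
    (hpmin : ∀ q : ℕ, 0 < q → (∀ v ∈ V, ∀ i, ∃ n : ℤ, (q : ℝ) * v i = (n : ℝ)) → p ≤ q) :
    (∃ q : Fin p → Polynomial ℚ,
      ((∀ i, (q i).degree ≤ (d : ℕ)) ∧ (∃ i, (q i).degree = (d : ℕ))) ∧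
      ∀ t : ℕ, 1 ≤ t →
        ((DSet d u ((t : ℝ) • P)).ncard : ℚ) = (q (resMod p hp (t : ℤ))).eval (t : ℚ)) ∧
    ((∀ v ∈ V, ∀ i, ∃ n : ℤ, v i = (n : ℝ)) →
      ∃ q : Polynomial ℚ, q.degree = (d : ℕ) ∧
        ∀ t : ℕ, 1 ≤ t →
          ((DSet d u ((t : ℝ) • P)).ncard : ℚ) = q.eval (t : ℚ)) := by
  subst hP
  refine ⟨exists_quasipolynomial_ncard_DSet_degree hd hp V u hint hpV, fun hV => ?_⟩
  obtain ⟨q, ⟨-, i, hi⟩, H⟩ := exists_quasipolynomial_ncard_DSet_degree hd one_pos V u hint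
    (by simpa using hV)
  refine ⟨q i, hi, fun t ht => ?_⟩
  rw [H t ht, Subsingleton.elim i (resMod 1 one_pos t)]

end
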